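/- arXiv:2108.08817 — 6 statements merged into one kernel-verified Lean document; each statement's English description precedes it below -/
import Mathlib

section
/- Let s be a positive integer and let Γ = (a_{i,j}) (i = 1,…,s; j = 1,2,…) be complex numbers. Define L : ℂ[x]^s → ℂ[x] by L(f_1,…,f_s) = ∑_{i=1}^{s} ∑_{j=1}^{∞} a_{i,j} · f_i^{(j)} (only finitely many terms are nonzero for any polynomials f_1,…,f_s). Let M_Γ be the set of all F ∈ ℂ[x,y] such that [F]_n = L([F]_{n−s}, …, [F]_{n−1}) for every n ≥ s. Then M_Γ is an L-module of order s (in particular, M_Γ is a submodule of ℂ[x,y]). -/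
open Polynomial
open scoped Pointwise BigOperators

noncomputable section

/-- `ℂ[x,y]` as `ℂ[x][y]`: outer variable is `y`, inner variable is `x`. -/
abbrev R2 : Type := Polynomial (Polynomial ℂ)

/-- The polynomial `(x,y) ↦ F(x+a, y+b)`. -/
noncomputable def polyTranslate (a b : ℂ) (F : R2) : R2 :=
  (F.map (aeval (X + C a) : Polynomial ℂ →ₐ[ℂ] Polynomial ℂ).toRingHom).comp (X + C (C b))

/-- A submodule of `ℂ[x,y]`: a translation invariant `ℂ`-linear subspace. -/
def IsSubmodule (M : Set R2) : Prop :=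
  (0 ∈ M) ∧ (∀ F ∈ M, ∀ G ∈ M, F + G ∈ M) ∧ (∀ (c : ℂ), ∀ F ∈ M, c • F ∈ M) ∧
    (∀ F ∈ M, ∀ a b : ℂ, polyTranslate a b F ∈ M)

/-- The `n`-th coordinate polynomial `[F]_n ∈ ℂ[x]`, so that `F = ∑ [F]_n · yⁿ/n!`. -/
noncomputable def coordPoly (F : R2) (n : ℕ) : Polynomial ℂ := (n.factorial : ℂ) • F.coeff n

/-- An L-module of order `s`. -/
def IsLModule (s : ℕ) (M : Set R2) : Prop :=
  IsSubmodule M ∧ ∀ F ∈ M, (∀ n < s, coordPoly F n = 0) → F = 0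

/-- `M_d = {F : deg_x F < d}`. -/
def Md (d : ℕ) : Set R2 := {F | ∀ n, (coordPoly F n).degree < (d : WithBot ℕ)}

/-- The map `L(f_1,…,f_s) = ∑_{i=1}^{s} ∑_{j=1}^{∞} a_{i,j} f_i^{(j)}`, where `a i j`
represents `a_{i+1, j+1}`. -/
noncomputable def Lmap {s : ℕ} (a : Fin s → ℕ → ℂ) (f : Fin s → Polynomial ℂ) :
    Polynomial ℂ :=
  ∑ i : Fin s, ∑ᶠ j : ℕ, a i (j + 1) • (Polynomial.derivative^[j + 1] (f i))

/-- `V_{A,s} = {([F]_0, …, [F]_{s−1}) : F ∈ A}`. -/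
def Vset (A : Set R2) (s : ℕ) : Set (Fin s → Polynomial ℂ) :=
  {φ | ∃ F ∈ A, ∀ i : Fin s, φ i = coordPoly F i}

/-- A submodule is decomposable if it is the sum of finitely many proper submodules. -/
def Decomposable (M : Set R2) : Prop :=
  ∃ (k : ℕ) (A : Fin k → Set R2), 0 < k ∧ (∀ i, IsSubmodule (A i) ∧ A i ⊂ M) ∧
    M = ∑ i : Fin k, A i

theorem Lmap_summand_support_finite (c : ℕ → ℂ) (f : Polynomial ℂ) :
    (Function.support fun j : ℕ => c (j + 1) • derivative^[j + 1] f).Finite := by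
  refine (Set.finite_lt_nat f.natDegree).subset fun j hj => ?_
  by_contra h
  refine hj ?_
  have h' : f.natDegree < j + 1 := by
    simp only [Set.mem_ofPred_eq, not_lt] at h
    omega
  simp only [iterate_derivative_eq_zero h', smul_zero]

theorem Lmap_add {s : ℕ} (a : Fin s → ℕ → ℂ) (f g : Fin s → Polynomial ℂ) :
    Lmap a (f + g) = Lmap a f + Lmap a g := by
  unfold Lmap
  rw [← Finset.sum_add_distrib]
  refine Finset.sum_congr rfl fun i _ => ?_
  rw [← finsum_add_distrib (Lmap_summand_support_finite (a i) (f i))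
    (Lmap_summand_support_finite (a i) (g i))]
  simp only [Pi.add_apply, iterate_map_add, smul_add]

theorem Lmap_smul {s : ℕ} (a : Fin s → ℕ → ℂ) (c : ℂ) (f : Fin s → Polynomial ℂ) :
    Lmap a (c • f) = c • Lmap a f := by
  unfold Lmap
  rw [Finset.smul_sum]
  refine Finset.sum_congr rfl fun i _ => ?_
  rw [smul_finsum' c (Lmap_summand_support_finite (a i) (f i))]
  simp only [Pi.smul_apply, iterate_derivative_smul, smul_comm c]

/-- `Lmap` as a linear map. -/
def LmapLinear {s : ℕ} (a : Fin s → ℕ → ℂ) : (Fin s → Polynomial ℂ) →ₗ[ℂ] Polynomial ℂ where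
  toFun := Lmap a
  map_add' := Lmap_add a
  map_smul' := Lmap_smul a

theorem Lmap_zero {s : ℕ} (a : Fin s → ℕ → ℂ) : Lmap a (fun _ => 0) = 0 :=
  (LmapLinear a).map_zero

theorem Lmap_sum_smul {s : ℕ} (a : Fin s → ℕ → ℂ) (t : Finset ℕ) (c : ℕ → ℂ)
    (f : ℕ → Fin s → Polynomial ℂ) :
    Lmap a (fun i => ∑ k ∈ t, c k • f k i) = ∑ k ∈ t, c k • Lmap a (f k) := by
  have h := map_sum (LmapLinear a) (fun k => c k • f k) t
  simp only [map_smul] at h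
  rw [show (fun i => ∑ k ∈ t, c k • f k i) = ∑ k ∈ t, c k • f k by
    ext1 i; simp only [Finset.sum_apply, Pi.smul_apply]]
  exact h

theorem iterate_derivative_taylor (α : ℂ) (f : Polynomial ℂ) (j : ℕ) :
    derivative^[j] (taylor α f) = taylor α (derivative^[j] f) := by
  induction j with
  | zero => rfl
  | succ j ih =>
    rw [Function.iterate_succ_apply', ih, Function.iterate_succ_apply']
    simp [taylor_apply, derivative_comp]

theorem Lmap_taylor {s : ℕ} (a : Fin s → ℕ → ℂ) (α : ℂ) (f : Fin s → Polynomial ℂ) :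
    Lmap a (fun i => taylor α (f i)) = taylor α (Lmap a f) := by
  unfold Lmap
  rw [map_sum]
  refine Finset.sum_congr rfl fun i _ => ?_
  have h := (taylor α).toAddMonoidHom.map_finsum (Lmap_summand_support_finite (a i) (f i))
  simp only [LinearMap.toAddMonoidHom_coe, map_smul] at h
  rw [h]
  simp only [iterate_derivative_taylor]

theorem coordPoly_add (F G : R2) (n : ℕ) :
    coordPoly (F + G) n = coordPoly F n + coordPoly G n := by
  simp [coordPoly]

theorem coordPoly_smul (c : ℂ) (F : R2) (n : ℕ) :
    coordPoly (c • F) n = c • coordPoly F n := by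
  simp [coordPoly, smul_comm c]

theorem eq_zero_of_coordPoly_eq_zero {F : R2} (h : ∀ n, coordPoly F n = 0) : F = 0 := by
  ext1 n
  simpa [coordPoly, Nat.factorial_ne_zero] using h n

/-- Taylor expansion of the coordinate polynomials of a translate. -/
theorem coordPoly_polyTranslate (α β : ℂ) (F : R2) {n N : ℕ} (hN : F.natDegree < N) :
    coordPoly (polyTranslate α β F) n =
      ∑ k ∈ Finset.range N, (β ^ k / (k.factorial : ℂ)) • taylor α (coordPoly F (n + k)) := by
  set G : R2 := F.map (aeval (X + C α) : Polynomial ℂ →ₐ[ℂ] Polynomial ℂ).toRingHom with hG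
  have hcoeff (m : ℕ) : G.coeff m = taylor α (F.coeff m) := by
    rw [hG, coeff_map]
    rfl
  have hdeg : (hasseDeriv n G).natDegree < N :=
    ((natDegree_hasseDeriv_le G n).trans (Nat.sub_le _ _)).trans_lt
      (natDegree_map_le.trans_lt hN)
  have hT : polyTranslate α β F = taylor (C β) G := by rw [taylor_apply]; rfl
  rw [coordPoly, hT, taylor_coeff, eval_eq_sum_range' hdeg, Finset.smul_sum]
  refine Finset.sum_congr rfl fun k _ => ?_
  rw [hasseDeriv_coeff, hcoeff, coordPoly, map_smul, add_comm n k, smul_smul, ← C_pow,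
    ← map_natCast C, mul_comm, ← mul_assoc, ← C_mul, ← smul_eq_C_mul, smul_smul]
  congr 1
  have hk : (k.factorial : ℂ) ≠ 0 := Nat.cast_ne_zero.mpr k.factorial_ne_zero
  have h : ((k + n).choose n * k.factorial * n.factorial : ℂ) = (k + n).factorial := by
    have := Nat.add_choose_mul_factorial_mul_factorial k n
    exact_mod_cast this
  rw [← h]
  field_simp

/-- For any coefficients `Γ = (a_{i,j})`, the set `M_Γ` of polynomials satisfying the
recursion `[F]_n = L([F]_{n−s},…,[F]_{n−1})` for all `n ≥ s` is an L-module of order `s`. -/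
theorem stmt1 (s : ℕ) (hs : 0 < s) (a : Fin s → ℕ → ℂ) :
    IsLModule s {F : R2 | ∀ n : ℕ, s ≤ n →
      coordPoly F n = Lmap a (fun i : Fin s => coordPoly F (n - s + i))} := by
  refine ⟨⟨fun n _ => ?_, fun F hF G hG n hn => ?_, fun c F hF n hn => ?_,
    fun F hF α β n hn => ?_⟩, fun F hF h0 => ?_⟩
  · simp [coordPoly, Lmap_zero]
  · simp only [coordPoly_add]
    rw [hF n hn, hG n hn]
    exact (Lmap_add a _ _).symm
  · simp only [coordPoly_smul]
    rw [hF n hn]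
    exact (Lmap_smul a c _).symm
  · simp only [coordPoly_polyTranslate α β F (Nat.lt_succ_self _)]
    rw [Lmap_sum_smul]
    refine Finset.sum_congr rfl fun k _ => ?_
    rw [Lmap_taylor, hF (n + k) (hn.trans (Nat.le_add_right n k))]
    have hindex (i : Fin s) : n + k - s + i = n - s + i + k := by omega
    simp only [hindex]
  · refine eq_zero_of_coordPoly_eq_zero fun n => ?_
    induction n using Nat.strong_induction_on with
    | _ n ih =>
      rcases lt_or_ge n s with hn | hn
      · exact h0 n hn
      · rw [hF n hn]
        have hprev (i : Fin s) : coordPoly F (n - s + i) = 0 := ih _ (by omega)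
        simp only [hprev, Lmap_zero]
end
end

section
/- If A and B are L-modules in ℂ[x,y] (of some orders s_1 and s_2 respectively) and d_1, d_2 ≥ 0 are integers with M_{d_1} + A = M_{d_2} + B, then d_1 = d_2. -/
open Polynomial
open scoped Pointwise BigOperators

noncomputable section

/-- The forward difference `q(x+1) - q(x)` of a polynomial in one variable. -/
def polyDiff (q : Polynomial ℂ) : Polynomial ℂ := q.comp (X + C 1) - q

lemma eval_polyDiff_iterate (k : ℕ) (q : Polynomial ℂ) (x : ℂ) :
    (polyDiff^[k] q).eval x = (fwdDiff (1 : ℂ))^[k] (fun t => q.eval t) x := by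
  induction k generalizing q with
  | zero => rfl
  | succ k ih =>
    rw [Function.iterate_succ_apply, Function.iterate_succ_apply, ih]
    have hd : (fun t => (polyDiff q).eval t) = fwdDiff (1 : ℂ) (fun t => q.eval t) := by
      ext t
      simp [polyDiff, fwdDiff]
    rw [hd]

lemma polyDiff_iterate_add (k : ℕ) (p q : Polynomial ℂ) :
    polyDiff^[k] (p + q) = polyDiff^[k] p + polyDiff^[k] q := by
  induction k generalizing p q with
  | zero => rfl
  | succ k ih =>
    simp only [Function.iterate_succ_apply, ← ih]
    congr 1
    simp only [polyDiff, add_comp]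
    ring

lemma polyDiff_iterate_eq_zero {k : ℕ} {q : Polynomial ℂ} (hq : q.degree < (k : WithBot ℕ)) :
    polyDiff^[k] q = 0 := by
  rcases eq_or_ne q 0 with rfl | h0
  · exact Function.iterate_fixed (by simp [polyDiff]) k
  · refine Polynomial.funext fun x => ?_
    have hdeg : q.natDegree < k := (natDegree_lt_iff_degree_lt h0).2 hq
    simpa [eval_polyDiff_iterate] using
      congrFun (Polynomial.fwdDiff_iter_eq_zero_of_degree_lt hdeg) x

lemma polyDiff_iterate_X_pow (k : ℕ) :
    polyDiff^[k] (X ^ k : Polynomial ℂ) ≠ 0 := by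
  intro h
  have := eval_polyDiff_iterate k (X ^ k) 0
  simp [h, fwdDiff_iter_eq_factorial, eq_comm, Nat.factorial_ne_zero] at this

/-- The forward difference `F(x+1, y) - F(x, y)`. -/
def diffX (F : R2) : R2 := polyTranslate 1 0 F + (-1 : ℂ) • F

lemma coeff_diffX (F : R2) (n : ℕ) : (diffX F).coeff n = polyDiff (F.coeff n) := by
  simp only [diffX, polyTranslate, polyDiff, map_zero, add_zero, comp_X, coeff_add, coeff_map,
    neg_smul, one_smul, sub_eq_add_neg]
  rfl

lemma coeff_diffX_iterate (k : ℕ) (F : R2) (n : ℕ) :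
    (diffX^[k] F).coeff n = polyDiff^[k] (F.coeff n) := by
  induction k generalizing F with
  | zero => rfl
  | succ k ih => rw [Function.iterate_succ_apply, Function.iterate_succ_apply, ih, coeff_diffX]

lemma IsSubmodule.diffX_iterate_mem {M : Set R2} (hM : IsSubmodule M) (k : ℕ) {F : R2}
    (hF : F ∈ M) : diffX^[k] F ∈ M := by
  induction k generalizing F with
  | zero => exact hF
  | succ k ih => exact ih (hM.2.1 _ (hM.2.2.2 _ hF 1 0) _ (hM.2.2.1 (-1) _ hF))

lemma coordPoly_eq_zero_iff (F : R2) (n : ℕ) : coordPoly F n = 0 ↔ F.coeff n = 0 := by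
  simp [coordPoly, Nat.factorial_ne_zero]

lemma degree_coordPoly (F : R2) (n : ℕ) : (coordPoly F n).degree = (F.coeff n).degree :=
  degree_smul_of_smul_regular _ (IsSMulRegular.of_ne_zero (by simp [Nat.factorial_ne_zero]))

lemma le_of_Md_subset {s d₁ d₂ : ℕ} {A : Set R2} (hA : IsLModule s A)
    (h : Md d₂ ⊆ Md d₁ + A) : d₂ ≤ d₁ := by
  by_contra! hlt
  have hmem : (monomial s (X ^ d₁) : R2) ∈ Md d₂ := by
    intro n
    rw [degree_coordPoly, coeff_monomial]
    split_ifs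
    · simpa using hlt
    · simp
  obtain ⟨m, hm, a, ha, hma⟩ := Set.mem_add.1 (h hmem)
  have hm0 (n : ℕ) : polyDiff^[d₁] (m.coeff n) = 0 :=
    polyDiff_iterate_eq_zero (by simpa only [degree_coordPoly] using hm n)
  have key (n : ℕ) : (diffX^[d₁] a).coeff n =
      polyDiff^[d₁] ((monomial s (X ^ d₁) : R2).coeff n) := by
    rw [← hma, coeff_add, polyDiff_iterate_add, coeff_diffX_iterate, hm0, zero_add]
  have hzero : diffX^[d₁] a = 0 := by
    refine hA.2 _ (hA.1.diffX_iterate_mem d₁ ha) fun n hn => ?_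
    rw [coordPoly_eq_zero_iff, key, coeff_monomial, if_neg hn.ne']
    exact Function.iterate_fixed (by simp [polyDiff]) d₁
  have hs := key s
  rw [hzero, coeff_monomial, if_pos rfl, coeff_zero] at hs
  exact polyDiff_iterate_X_pow d₁ hs.symm

lemma Md_subset_add {M : Set R2} (hM : IsSubmodule M) (d : ℕ) : Md d ⊆ Md d + M :=
  fun F hF => Set.mem_add.2 ⟨F, hF, 0, hM.1, add_zero F⟩

/-- If `A`, `B` are L-modules and `M_{d₁} + A = M_{d₂} + B`, then `d₁ = d₂`. -/
theorem stmt3 (s₁ s₂ : ℕ) (hs₁ : 0 < s₁) (hs₂ : 0 < s₂) (A B : Set R2)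
    (hA : IsLModule s₁ A) (hB : IsLModule s₂ B) (d₁ d₂ : ℕ)
    (h : Md d₁ + A = Md d₂ + B) : d₁ = d₂ := by
  exact le_antisymm (le_of_Md_subset hB (h ▸ Md_subset_add hA.1 d₁))
    (le_of_Md_subset hA (h ▸ Md_subset_add hB.1 d₂))
end
end

section
/- Let s be a positive integer. The system of translation invariant linear subspaces of ℂ[x]^s has the minimal condition: if V_1 ⊇ V_2 ⊇ V_3 ⊇ … is a decreasing sequence of translation invariant ℂ-linear subspaces of ℂ[x]^s, then there is a positive integer K such that V_k = V_K for every k ≥ K. -/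
open Polynomial

/-- A translation invariant `ℂ`-linear subspace of `ℂ[x]^s`. -/
def IsTransSubspace (s : ℕ) (V : Set (Fin s → Polynomial ℂ)) : Prop :=
  (0 ∈ V) ∧ (∀ φ ∈ V, ∀ ψ ∈ V, φ + ψ ∈ V) ∧ (∀ (c : ℂ), ∀ φ ∈ V, c • φ ∈ V) ∧
    (∀ φ ∈ V, ∀ a : ℂ, (fun i => (φ i).comp (X + C a)) ∈ V)

section UnitTranslation

variable {K : Type*} [Field K]

/-- The forward difference `f(x + 1) - f(x)` lowers the degree bound by one. -/
lemma taylor_one_sub_self_mem_degreeLT {n : ℕ} {f : K[X]} (hf : f ∈ degreeLT K (n + 1)) :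
    taylor 1 f - f ∈ degreeLT K n := by
  rw [mem_degreeLT, degree_lt_iff_coeff_zero] at hf ⊢
  intro m hm
  have hd : (hasseDeriv m f).natDegree < 1 := by
    have h1 := natDegree_hasseDeriv_le f m
    have h2 : f.natDegree ≤ n := natDegree_le_iff_coeff_eq_zero.2 fun N hN => hf N hN
    omega
  rw [coeff_sub, taylor_coeff, eval_eq_sum_range' hd]
  simp [hasseDeriv_coeff]

lemma coeff_taylor_one_sub_self {n : ℕ} {f : K[X]} (hf : f ∈ degreeLT K (n + 2)) :
    (taylor 1 f - f).coeff n = (n + 1) * f.coeff (n + 1) := by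
  rw [mem_degreeLT, degree_lt_iff_coeff_zero] at hf
  have hd : (hasseDeriv n f).natDegree < 2 := by
    have h1 := natDegree_hasseDeriv_le f n
    have h2 : f.natDegree ≤ n + 1 := natDegree_le_iff_coeff_eq_zero.2 fun N hN => hf N hN
    omega
  rw [coeff_sub, taylor_coeff, eval_eq_sum_range' hd]
  simp [hasseDeriv_coeff, Finset.sum_range_succ, add_comm 1 n]

/-- In characteristic zero, a subspace of `K[X]` stable under `x ↦ x + 1` that contains a
polynomial of degree `n` contains all polynomials of degree at most `n`. -/
lemma degreeLT_le_of_taylor_one_mem [CharZero K] {W : Submodule K K[X]}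
    (hW : ∀ f ∈ W, taylor 1 f ∈ W) {n : ℕ} {f : K[X]} (hfW : f ∈ W)
    (hf : f ∈ degreeLT K (n + 1)) (hfn : f.coeff n ≠ 0) : degreeLT K (n + 1) ≤ W := by
  induction n generalizing f with
  | zero =>
    intro g hg
    have key : g = (g.coeff 0 / f.coeff 0) • f := by
      rw [mem_degreeLT, degree_lt_iff_coeff_zero] at hf hg
      ext m
      rcases Nat.eq_zero_or_pos m with rfl | hm
      · simp [hfn]
      · simp [hf m hm, hg m hm]
    rw [key]
    exact W.smul_mem _ hfW
  | succ n ih =>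
    have hlow : degreeLT K (n + 1) ≤ W := by
      refine ih (W.sub_mem (hW f hfW) hfW) (taylor_one_sub_self_mem_degreeLT hf) ?_
      rw [coeff_taylor_one_sub_self hf]
      exact mul_ne_zero (Nat.cast_add_one_ne_zero n) hfn
    intro g hg
    have key : g - (g.coeff (n + 1) / f.coeff (n + 1)) • f ∈ degreeLT K (n + 1) := by
      rw [mem_degreeLT, degree_lt_iff_coeff_zero] at hf hg ⊢
      intro m hm
      rcases hm.eq_or_lt with rfl | hm
      · simp [hfn]
      · simp [hf m hm, hg m hm]
    simpa using W.add_mem (hlow key) (W.smul_mem (g.coeff (n + 1) / f.coeff (n + 1)) hfW)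

/-- If `W` is stable under `x ↦ x + 1` and does not contain all polynomials of degree at most `n`,
then all its members have degree less than `n`. -/
lemma le_degreeLT_of_not_degreeLT_le [CharZero K] {W : Submodule K K[X]}
    (hW : ∀ f ∈ W, taylor 1 f ∈ W) {n : ℕ} (hn : ¬ degreeLT K (n + 1) ≤ W) :
    W ≤ degreeLT K n := by
  intro f hf
  by_contra hfn
  rw [mem_degreeLT, not_lt] at hfn
  have h0 : f ≠ 0 := by
    rintro rfl
    simp at hfn
  have hle : n ≤ f.natDegree := le_natDegree_of_coe_le_degree hfn
  refine hn (le_trans (degreeLT_mono (by omega)) (degreeLT_le_of_taylor_one_mem hW hf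
    (n := f.natDegree) ?_ (by simpa using h0)))
  rw [mem_degreeLT]
  exact lt_of_le_of_lt degree_le_natDegree (by exact_mod_cast Nat.lt_succ_self _)

/-- In characteristic zero, `K[X]` is Artinian as a module over the polynomials in the translation
`x ↦ x + 1`. -/
instance isArtinian_aeval_taylor_one [CharZero K] :
    IsArtinian K[X] (Module.AEval' (taylor (1 : K))) := by
  set e := Module.AEval'.of (taylor (1 : K))
  let U (W : Submodule K[X] (Module.AEval' (taylor (1 : K)))) : Submodule K K[X] :=
    (W.restrictScalars K).comap e.toLinearMap
  have hU (W) : ∀ f ∈ U W, taylor 1 f ∈ U W := fun f hf => by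
    have := W.smul_mem X (show e f ∈ W from hf)
    rwa [Module.AEval'.X_smul_of] at this
  have hle {W W'} (h : U W ≤ U W') : W ≤ W' := fun w hw => by
    obtain ⟨f, rfl⟩ := e.surjective w
    exact h hw
  have hacc (n : ℕ) : ∀ W, U W ≤ degreeLT K n → Acc (· < ·) W := by
    induction n with
    | zero =>
      refine fun W hW => ⟨W, fun W' hlt => absurd (hle fun f hf => ?_) hlt.not_ge⟩
      have := hW hf
      rw [mem_degreeLT, Nat.cast_zero, Nat.WithBot.lt_zero_iff, degree_eq_bot] at this
      exact this ▸ zero_mem _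
    | succ n ih =>
      exact fun W hW => ⟨W, fun W' hlt => ih W' <| le_degreeLT_of_not_degreeLT_le (hU W')
        fun h => hlt.not_ge (hle (hW.trans h))⟩
  refine ⟨⟨fun W => ⟨W, fun W' hlt => ?_⟩⟩⟩
  by_cases h : ∃ n, ¬ degreeLT K (n + 1) ≤ U W'
  · obtain ⟨n, hn⟩ := h
    exact hacc n W' (le_degreeLT_of_not_degreeLT_le (hU W') hn)
  · push Not at h
    refine absurd (hle fun f _ => h f.natDegree ?_) hlt.not_ge
    rw [mem_degreeLT]
    exact lt_of_le_of_lt degree_le_natDegree (by exact_mod_cast Nat.lt_succ_self _)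

end UnitTranslation

/-- A translation invariant subspace, as a submodule over the polynomials in the translation
`x ↦ x + 1`. -/
def IsTransSubspace.toSubmodule {s : ℕ} {V : Set (Fin s → ℂ[X])} (hV : IsTransSubspace s V) :
    Submodule ℂ[X] (Fin s → Module.AEval' (taylor (1 : ℂ))) where
  carrier := {φ | (fun i => (Module.AEval'.of (taylor (1 : ℂ))).symm (φ i)) ∈ V}
  zero_mem' := by simpa [Pi.zero_def] using hV.1
  add_mem' {φ ψ} hφ hψ := by
    rw [Set.mem_ofPred_eq] at hφ hψ
    simpa [Pi.add_def] using hV.2.1 _ hφ _ hψ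
  smul_mem' p φ hφ := by
    rw [Set.mem_ofPred_eq] at hφ ⊢
    obtain ⟨-, hadd, hsmul, htrans⟩ := hV
    induction p using Polynomial.induction_on' generalizing φ with
    | add p q hp hq => simpa [add_smul, Pi.add_def] using hadd _ (hp φ hφ) _ (hq φ hφ)
    | monomial n a =>
      induction n generalizing φ with
      | zero => simpa [Pi.smul_def] using hsmul a _ hφ
      | succ n ih =>
        have := ih ((X : ℂ[X]) • φ) ?_
        · rwa [smul_smul, monomial_mul_X] at this
        · convert htrans _ hφ 1 using 2 with i
          obtain ⟨f, hf⟩ := (Module.AEval'.of (taylor (1 : ℂ))).surjective (φ i)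
          simp [← hf, Module.AEval'.X_smul_of, taylor_apply]

lemma IsTransSubspace.mem_toSubmodule {s : ℕ} {V : Set (Fin s → ℂ[X])}
    (hV : IsTransSubspace s V) (φ : Fin s → ℂ[X]) :
    (fun i => Module.AEval'.of (taylor (1 : ℂ)) (φ i)) ∈ hV.toSubmodule ↔ φ ∈ V := by
  change (fun i => (Module.AEval'.of (taylor (1 : ℂ))).symm
    (Module.AEval'.of (taylor (1 : ℂ)) (φ i))) ∈ V ↔ φ ∈ V
  simp

/-- Lemma 3 of the paper: the translation invariant linear subspaces of `ℂ[x]^s`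
satisfy the minimal condition. -/
theorem stmt9 (s : ℕ) (hs : 0 < s) (V : ℕ → Set (Fin s → Polynomial ℂ))
    (hV : ∀ k, IsTransSubspace s (V k)) (hmono : ∀ k, V (k + 1) ⊆ V k) :
    ∃ K : ℕ, ∀ k, K ≤ k → V k = V K := by
  have hanti : Antitone fun k => (hV k).toSubmodule :=
    antitone_nat_of_succ_le fun k _ hφ => hmono k hφ
  obtain ⟨K, hK⟩ := IsArtinian.monotone_stabilizes (⟨_, hanti⟩ :
    ℕ →o (Submodule ℂ[X] (Fin s → Module.AEval' (taylor (1 : ℂ))))ᵒᵈ)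
  refine ⟨K, fun k hk => Set.ext fun φ => ?_⟩
  have h : (hV K).toSubmodule = (hV k).toSubmodule := hK k hk
  rw [← (hV k).mem_toSubmodule, ← (hV K).mem_toSubmodule, h]
end

section
/- For every integer d ≥ 0, the submodule M_d of ℂ[x,y] is indecomposable: M_d cannot be written as the sum of finitely many proper submodules of M_d. -/
open Polynomial
open scoped Pointwise BigOperators

noncomputable section

theorem mem_Md_iff {d : ℕ} {F : R2} :
    F ∈ Md d ↔ ∀ n k, d ≤ k → (F.coeff n).coeff k = 0 := by
  have h (n : ℕ) : (n.factorial : ℂ) ≠ 0 := by exact_mod_cast n.factorial_ne_zero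
  simp [Md, coordPoly, Polynomial.degree_lt_iff_coeff_zero, h]

theorem eq_zero_of_mem_Md_zero {F : R2} (hF : F ∈ Md 0) : F = 0 := by
  ext n k
  simpa using mem_Md_iff.mp hF n k k.zero_le

theorem map_coeff_taylor_one {R : Type*} [CommRing R] (φ : R →+ ℂ) (F : R[X]) (n : ℕ)
    (h : ∀ k, n + 2 ≤ k → φ (F.coeff k) = 0) :
    φ ((taylor 1 F).coeff n) = φ (F.coeff n) + (n + 1) * φ (F.coeff (n + 1)) := by
  have hdeg : (hasseDeriv n F).natDegree < (hasseDeriv n F).natDegree + 1 + 1 := by omega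
  rw [taylor_coeff, eval_eq_sum_range' hdeg, map_sum, Finset.sum_range_succ',
    Finset.sum_range_succ', Finset.sum_eq_zero]
  · simp only [hasseDeriv_coeff, one_pow, mul_one, ← nsmul_eq_mul, map_nsmul]
    simp [add_comm]
  · intro k _
    simp only [hasseDeriv_coeff, one_pow, mul_one, ← nsmul_eq_mul, map_nsmul]
    rw [h _ (by omega), smul_zero]

theorem coeff_polyTranslate_x (F : R2) (n : ℕ) :
    (polyTranslate 1 0 F).coeff n = taylor 1 (F.coeff n) := by
  simp [polyTranslate, taylor_apply, aeval_def, comp, algebraMap_eq]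

theorem polyTranslate_y (F : R2) : polyTranslate 0 1 F = taylor 1 F := by
  have h : (aeval (X + C 0) : Polynomial ℂ →ₐ[ℂ] Polynomial ℂ) = AlgHom.id ℂ _ := by
    ext; simp
  rw [polyTranslate, h]
  simp only [taylor_apply, map_one]
  congr 1
  ext : 1
  simp

theorem IsSubmodule.add_smul_mem {A : Set R2} (hA : IsSubmodule A) {F G : R2}
    (hF : F ∈ A) (hG : G ∈ A) (c : ℂ) : F + c • G ∈ A :=
  hA.2.1 _ hF _ (hA.2.2.1 c _ hG)

/-- The elements of `A ∩ M_{j+1}` have coefficients of `x ^ j` of unbounded degree in `y`. -/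
def TopUnbounded (A : Set R2) (j : ℕ) : Prop :=
  ∀ m, ∃ F ∈ A, F ∈ Md (j + 1) ∧ ∃ n, m ≤ n ∧ (F.coeff n).coeff j ≠ 0

theorem TopUnbounded.pred {A : Set R2} (hA : IsSubmodule A) {j : ℕ}
    (h : TopUnbounded A (j + 1)) : TopUnbounded A j := by
  intro m
  obtain ⟨F, hF, hFM, n, hmn, hn⟩ := h m
  rw [mem_Md_iff] at hFM
  have key (i k : ℕ) (hk : j ≤ k) : ((polyTranslate 1 0 F + (-1 : ℂ) • F).coeff i).coeff k =
      (k + 1) * (F.coeff i).coeff (k + 1) := by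
    have := map_coeff_taylor_one (AddMonoidHom.id ℂ) (F.coeff i) k
      fun l hl => hFM i l (by omega)
    simp only [AddMonoidHom.id_apply] at this
    simp [coeff_polyTranslate_x, this]
  refine ⟨_, hA.add_smul_mem (hA.2.2.2 F hF 1 0) hF (-1), ?_, n, hmn, ?_⟩
  · rw [mem_Md_iff]
    intro i k hk
    rw [key i k (by omega), hFM i (k + 1) (by omega), mul_zero]
  · rw [key n j le_rfl]
    exact mul_ne_zero (by exact_mod_cast j.succ_ne_zero) hn

/-- `F ∈ A ∩ M_{j+1}` and the coefficient of `x ^ j` in `F` has degree exactly `n` in `y`. -/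
def HasTop (A : Set R2) (j n : ℕ) (F : R2) : Prop :=
  F ∈ A ∧ F ∈ Md (j + 1) ∧ (F.coeff n).coeff j ≠ 0 ∧ ∀ k, n < k → (F.coeff k).coeff j = 0

theorem HasTop.pred {A : Set R2} (hA : IsSubmodule A) {j n : ℕ} {F : R2}
    (h : HasTop A j (n + 1) F) : ∃ G, HasTop A j n G := by
  obtain ⟨hF, hFM, hn, htop⟩ := h
  rw [mem_Md_iff] at hFM
  have key (i k : ℕ) (hik : ∀ l, i + 2 ≤ l → (F.coeff l).coeff k = 0) :
      ((polyTranslate 0 1 F + (-1 : ℂ) • F).coeff i).coeff k =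
      (i + 1) * (F.coeff (i + 1)).coeff k := by
    have := map_coeff_taylor_one (lcoeff ℂ k).toAddMonoidHom F i hik
    simp only [LinearMap.toAddMonoidHom_coe, lcoeff_apply] at this
    simp [polyTranslate_y, this]
  refine ⟨_, hA.add_smul_mem (hA.2.2.2 F hF 0 1) hF (-1), ?_, ?_, ?_⟩
  · rw [mem_Md_iff]
    intro i k hk
    rw [key i k fun l _ => hFM l k hk, hFM _ k hk, mul_zero]
  · rw [key n j fun l hl => htop l (by omega)]
    exact mul_ne_zero (by exact_mod_cast n.succ_ne_zero) hn
  · intro k hk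
    rw [key k j fun l hl => htop l (by omega), htop (k + 1) (by omega), mul_zero]

theorem TopUnbounded.exists_hasTop {A : Set R2} (hA : IsSubmodule A) {j : ℕ}
    (h : TopUnbounded A j) (m : ℕ) : ∃ G, HasTop A j m G := by
  obtain ⟨F, hF, hFM, n, hmn, hn⟩ := h m
  obtain ⟨N, hmN, G, hG⟩ : ∃ N, m ≤ N ∧ ∃ G, HasTop A j N G := by
    let p : ℕ → Prop := fun i => (F.coeff i).coeff j ≠ 0
    classical
    have hnd : n ≤ F.natDegree := le_natDegree_of_ne_zero fun h0 => hn (by simp [h0])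
    refine ⟨Nat.findGreatest p F.natDegree, hmn.trans (Nat.le_findGreatest hnd hn), F, hF, hFM,
      Nat.findGreatest_spec (P := p) hnd hn, fun k hk => ?_⟩
    by_cases hkd : k ≤ F.natDegree
    · exact not_not.mp (Nat.findGreatest_is_greatest hk hkd)
    · simp [coeff_eq_zero_of_natDegree_lt (not_le.mp hkd)]
  induction N, hmN using Nat.le_induction generalizing G with
  | base => exact ⟨G, hG⟩
  | succ N _ ih =>
    obtain ⟨G', hG'⟩ := hG.pred hA
    exact ih G' hG'

theorem TopUnbounded.Md_subset_succ {A : Set R2} (hA : IsSubmodule A) {j : ℕ}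
    (h : TopUnbounded A j) (hj : Md j ⊆ A) : Md (j + 1) ⊆ A := by
  have key (N : ℕ) : ∀ F ∈ Md (j + 1), (∀ n, N ≤ n → (F.coeff n).coeff j = 0) → F ∈ A := by
    induction N with
    | zero =>
      intro F hF h0
      refine hj (mem_Md_iff.mpr fun n k hk => ?_)
      rcases hk.eq_or_lt with rfl | hk
      · exact h0 n n.zero_le
      · exact mem_Md_iff.mp hF n k hk
    | succ N ih =>
      intro F hF h0
      obtain ⟨G, hG, hGM, hGN, hGtop⟩ := h.exists_hasTop hA N
      set c : ℂ := (F.coeff N).coeff j / (G.coeff N).coeff j with hc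
      have hmem : F + (-c) • G ∈ A := by
        refine ih _ (mem_Md_iff.mpr fun n k hk => ?_) fun n hn => ?_
        · simp [mem_Md_iff.mp hF n k hk, mem_Md_iff.mp hGM n k hk]
        · rcases hn.eq_or_lt with rfl | hn
          · simp [hc, div_mul_cancel₀ _ hGN]
          · simp [h0 n hn, hGtop n hn]
      have := hA.add_smul_mem hmem hG c
      rwa [neg_smul, neg_add_cancel_right] at this
  intro F hF
  refine key (F.natDegree + 1) F hF fun n hn => ?_
  simp [coeff_eq_zero_of_natDegree_lt (show F.natDegree < n by omega)]

theorem TopUnbounded.Md_subset {A : Set R2} (hA : IsSubmodule A) {j : ℕ}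
    (h : TopUnbounded A j) : Md (j + 1) ⊆ A := by
  induction j with
  | zero =>
    refine h.Md_subset_succ hA fun F hF => ?_
    exact eq_zero_of_mem_Md_zero hF ▸ hA.1
  | succ j ih => exact h.Md_subset_succ hA (ih (h.pred hA))

theorem IsSubmodule.exists_top_bound {A : Set R2} (hA : IsSubmodule A) {d : ℕ}
    (hs : A ⊂ Md (d + 1)) : ∃ m, ∀ F ∈ A, ∀ n, m ≤ n → (F.coeff n).coeff d = 0 := by
  by_contra! h
  refine hs.2 (TopUnbounded.Md_subset hA fun m => ?_)
  obtain ⟨F, hF, n, hmn, hn⟩ := h m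
  exact ⟨F, hF, hs.1 hF, n, hmn, hn⟩

/-- `M_d` is an indecomposable submodule of `ℂ[x,y]` for every `d`. -/
theorem stmt11 (d : ℕ) : ¬ Decomposable (Md d) := by
  rintro ⟨k, A, hk, hA, hsum⟩
  cases d with
  | zero =>
    refine (hA ⟨0, hk⟩).2.2 fun F hF => ?_
    exact eq_zero_of_mem_Md_zero hF ▸ (hA ⟨0, hk⟩).1.1
  | succ d =>
    choose m hm using fun i => (hA i).1.exists_top_bound (hA i).2
    let N := Finset.univ.sup m
    have hmem : (monomial N (monomial d (1 : ℂ)) : R2) ∈ Md (d + 1) := by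
      rw [mem_Md_iff]
      intro n l hl
      rw [coeff_monomial]
      split_ifs
      · exact coeff_monomial_of_ne _ (by omega)
      · simp
    rw [hsum, Set.mem_fintype_sum] at hmem
    obtain ⟨g, hg, hgs⟩ := hmem
    have hcoeff := congrArg (fun F : R2 => (F.coeff N).coeff d) hgs
    simp only [finsetSum_coeff, coeff_monomial_same] at hcoeff
    rw [Finset.sum_eq_zero fun i _ =>
      hm i (g i) (hg i) N (Finset.le_sup (Finset.mem_univ i))] at hcoeff
    exact zero_ne_one hcoeff
end
end

section
/- There exists a submodule M of ℂ[x,y] such that the polynomial F(x,y) = x does not belong to M, yet there is a sequence (G_n) of polynomials in M which converges to the function (x,y) ↦ x uniformly on every compact subset of ℂ² (polynomials being viewed as functions ℂ² → ℂ). In particular, M is not relatively closed in ℂ[x,y] with respect to the topology of uniform convergence on compact sets. -/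
open Polynomial
open scoped Pointwise BigOperators

noncomputable section

/-- Evaluation of `F ∈ ℂ[x][y]` at the point `(z, w) ∈ ℂ²`. -/
noncomputable def eval2 (F : R2) (p : ℂ × ℂ) : ℂ :=
  Polynomial.eval₂ (Polynomial.evalRingHom p.1) p.2 F

/-- The partial derivative with respect to the inner variable `x`. -/
def derivX : Module.End ℂ R2 :=
  Polynomial.lsum fun n => (monomial n).restrictScalars ℂ ∘ₗ derivative

/-- The `N`-th truncation of the power series `∑ a j * X ^ j`. -/
def truncSeries (a : ℕ → ℂ) (N : ℕ) : ℂ[X] := ∑ j ∈ Finset.range N, C (a j) * X ^ j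

/-- The solutions of `∂F/∂y = θ(∂/∂x) F`, where `θ = ∑ a j * X ^ j` is a formal power series. -/
def solutionSet (a : ℕ → ℂ) : Set R2 :=
  {F | ∃ N₀, ∀ N ≥ N₀, derivative F = aeval derivX (truncSeries a N) F}

/-- The part of degree at most `m` in `y` of `exp (y * p(d/dx)) f`. -/
def expFlow (m : ℕ) (p f : ℂ[X]) : R2 :=
  ∑ k ∈ Finset.range (m + 1), monomial k ((k.factorial : ℂ)⁻¹ • aeval derivative (p ^ k) f)

/-- The polynomial `X ^ m / m!`. -/
def dividedPow (m : ℕ) : ℂ[X] := (m.factorial : ℂ)⁻¹ • X ^ m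

lemma derivX_monomial (n : ℕ) (q : ℂ[X]) : derivX (monomial n q) = monomial n (derivative q) := by
  simp [derivX, Polynomial.lsum_apply, Polynomial.sum_monomial_index]

lemma derivX_coeff (F : R2) (n : ℕ) : (derivX F).coeff n = derivative (F.coeff n) := by
  induction F using Polynomial.induction_on' with
  | add p q hp hq => simp [hp, hq]
  | monomial k q =>
    rw [derivX_monomial, coeff_monomial, coeff_monomial]
    split_ifs <;> simp

lemma aeval_derivX_coeff (q : ℂ[X]) (F : R2) (n : ℕ) :
    (aeval derivX q F).coeff n = aeval (derivative : Module.End ℂ ℂ[X]) q (F.coeff n) := by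
  induction q using Polynomial.induction_on generalizing F with
  | C c => simp
  | add p q hp hq => simp [hp, hq]
  | monomial k c ih =>
    rw [pow_succ, ← mul_assoc, map_mul _ (C c * X ^ k), map_mul _ (C c * X ^ k),
      Module.End.mul_apply, Module.End.mul_apply, ih, aeval_X, aeval_X, derivX_coeff]

lemma polyTranslate_add (a b : ℂ) (F G : R2) :
    polyTranslate a b (F + G) = polyTranslate a b F + polyTranslate a b G := by
  simp [polyTranslate]

lemma polyTranslate_smul (a b c : ℂ) (F : R2) :
    polyTranslate a b (c • F) = c • polyTranslate a b F := by
  have h : ∀ H : R2, c • H = C (C c) * H := fun H => by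
    ext1 n
    simp [smul_eq_C_mul]
  simp [polyTranslate, h]

lemma polyTranslate_monomial (a b : ℂ) (n : ℕ) (q : ℂ[X]) :
    polyTranslate a b (monomial n q) = C (q.comp (X + C a)) * (X + C (C b)) ^ n := by
  rw [polyTranslate, map_monomial, monomial_comp]
  rfl

lemma derivX_C_mul_X_add_C_pow (q : ℂ[X]) (b : ℂ) (n : ℕ) :
    derivX (C q * (X + C (C b)) ^ n) = C (derivative q) * (X + C (C b)) ^ n := by
  ext1 k
  rw [derivX_coeff, coeff_C_mul, coeff_C_mul, coeff_X_add_C_pow, ← C_pow, derivative_mul]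
  simp

lemma derivX_polyTranslate (a b : ℂ) (F : R2) :
    derivX (polyTranslate a b F) = polyTranslate a b (derivX F) := by
  induction F using Polynomial.induction_on' with
  | add p q hp hq => simp [polyTranslate_add, hp, hq]
  | monomial k q =>
    rw [derivX_monomial, polyTranslate_monomial, polyTranslate_monomial, derivX_C_mul_X_add_C_pow,
      derivative_comp]
    simp

lemma aeval_derivX_polyTranslate (q : ℂ[X]) (a b : ℂ) (F : R2) :
    aeval derivX q (polyTranslate a b F) = polyTranslate a b (aeval derivX q F) := by
  induction q using Polynomial.induction_on generalizing F with
  | C c => simp [polyTranslate_smul]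
  | add p q hp hq => simp [hp, hq, polyTranslate_add]
  | monomial k c ih =>
    rw [pow_succ, ← mul_assoc, map_mul, Module.End.mul_apply, Module.End.mul_apply, aeval_X,
      derivX_polyTranslate, ih]

lemma derivative_polyTranslate (a b : ℂ) (F : R2) :
    derivative (polyTranslate a b F) = polyTranslate a b (derivative F) := by
  simp [polyTranslate, derivative_comp, derivative_map]

lemma isSubmodule_solutionSet (a : ℕ → ℂ) : IsSubmodule (solutionSet a) := by
  refine ⟨⟨0, by simp⟩, ?_, ?_, ?_⟩
  · rintro F ⟨N, hF⟩ G ⟨N', hG⟩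
    refine ⟨max N N', fun n hn => ?_⟩
    rw [derivative_add, map_add, hF n (le_of_max_le_left hn), hG n (le_of_max_le_right hn)]
  · rintro c F ⟨N, hF⟩
    refine ⟨N, fun n hn => ?_⟩
    rw [derivative_smul, map_smul, hF n hn]
  · rintro F ⟨N, hF⟩ b c
    refine ⟨N, fun n hn => ?_⟩
    rw [derivative_polyTranslate, aeval_derivX_polyTranslate, hF n hn]

lemma aeval_derivative_eq_zero {q f : ℂ[X]} {m : ℕ} (hq : X ^ (m + 1) ∣ q)
    (hf : f.natDegree ≤ m) : aeval (derivative : Module.End ℂ ℂ[X]) q f = 0 := by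
  obtain ⟨r, rfl⟩ := hq
  rw [mul_comm, map_mul, Module.End.mul_apply, map_pow, aeval_X, Module.End.pow_apply,
    iterate_derivative_eq_zero (by omega), map_zero]

lemma X_dvd_truncSeries {a : ℕ → ℂ} (h0 : a 0 = 0) (N : ℕ) : X ∣ truncSeries a N := by
  refine Finset.dvd_sum fun j _ => ?_
  rcases j with _ | j
  · simp [h0]
  · exact Dvd.dvd.mul_left (dvd_pow_self X (by omega)) _

lemma X_pow_dvd_truncSeries_sub (a : ℕ → ℂ) {m N : ℕ} (h : m ≤ N) :
    X ^ m ∣ truncSeries a N - truncSeries a m := by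
  rw [truncSeries, truncSeries, Finset.sum_range_sub_sum_range h]
  refine Finset.dvd_sum fun j hj => Dvd.dvd.mul_left (pow_dvd_pow X ?_) _
  simp at hj
  exact hj.2

lemma coeff_expFlow {m : ℕ} {p f : ℂ[X]} (hp : X ∣ p) (hf : f.natDegree ≤ m) (n : ℕ) :
    (expFlow m p f).coeff n =
      (n.factorial : ℂ)⁻¹ • aeval (derivative : Module.End ℂ ℂ[X]) (p ^ n) f := by
  rw [expFlow, finsetSum_coeff]
  simp only [coeff_monomial, Finset.sum_ite_eq', Finset.mem_range]
  split_ifs with h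
  · rfl
  · rw [aeval_derivative_eq_zero _ hf, smul_zero]
    exact (pow_dvd_pow X (by omega)).trans (pow_dvd_pow_of_dvd hp n)

lemma expFlow_mem_solutionSet {a : ℕ → ℂ} (h0 : a 0 = 0) {m : ℕ} {f : ℂ[X]}
    (hf : f.natDegree ≤ m) : expFlow m (truncSeries a (m + 1)) f ∈ solutionSet a := by
  refine ⟨m + 1, fun N hN => ?_⟩
  have hX := X_dvd_truncSeries h0 (m + 1)
  ext1 n
  rw [aeval_derivX_coeff, coeff_derivative, coeff_expFlow hX hf, coeff_expFlow hX hf]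
  have key : aeval (derivative : Module.End ℂ ℂ[X])
      (truncSeries a N * truncSeries a (m + 1) ^ n) f =
      aeval (derivative : Module.End ℂ ℂ[X]) (truncSeries a (m + 1) ^ (n + 1)) f := by
    rw [← sub_eq_zero, ← LinearMap.sub_apply, ← map_sub, pow_succ', ← sub_mul]
    exact aeval_derivative_eq_zero ((X_pow_dvd_truncSeries_sub a hN).mul_right _) hf
  rw [map_smul, ← Module.End.mul_apply, ← map_mul, key]
  have hn : ((n : ℂ) + 1) ≠ 0 := Nat.cast_add_one_ne_zero n
  have hc : ((n : ℂ[X]) + 1) = C ((n : ℂ) + 1) := by simp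
  rw [hc, mul_comm, ← smul_eq_C_mul, smul_smul, Nat.factorial_succ]
  push_cast
  congr 1
  field_simp

lemma natDegree_dividedPow_le (m : ℕ) : (dividedPow m).natDegree ≤ m :=
  (natDegree_smul_le _ _).trans (natDegree_X_pow_le m)

lemma derivative_iterate_dividedPow (m : ℕ) : derivative^[m] (dividedPow m) = 1 := by
  rw [dividedPow, iterate_derivative_smul, iterate_derivative_X_pow_eq_smul,
    Nat.descFactorial_self, Nat.sub_self, pow_zero, smul_smul,
    inv_mul_cancel₀ (Nat.cast_ne_zero.mpr m.factorial_ne_zero), one_smul]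

lemma expFlow_add_C_mul_X_pow {m : ℕ} (hm : 2 ≤ m) {p : ℂ[X]} (hp : X ∣ p) (c : ℂ) :
    expFlow m (p + C c * X ^ m) (dividedPow m) =
      expFlow m p (dividedPow m) + c • (X : R2) := by
  have hX : X ∣ p + C c * X ^ m := dvd_add hp (Dvd.dvd.mul_left (dvd_pow_self X (by omega)) _)
  have hf := natDegree_dividedPow_le m
  ext1 n
  rw [coeff_add, coeff_expFlow hX hf, coeff_expFlow hp hf, coeff_smul, coeff_X]
  rcases n with _ | _ | n
  · simp
  · simp [Module.End.pow_apply, derivative_iterate_dividedPow]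
  · rw [if_neg (by omega), smul_zero, add_zero]
    congr 1
    rw [← sub_eq_zero, ← LinearMap.sub_apply, ← map_sub]
    refine aeval_derivative_eq_zero ?_ hf
    rw [← (Commute.all (p + C c * X ^ m) p).mul_geom_sum₂, add_sub_cancel_left, pow_succ]
    refine mul_dvd_mul (dvd_mul_left _ _) (Finset.dvd_sum fun i _ => ?_)
    rcases i with _ | i
    · exact Dvd.dvd.mul_left (hp.trans (dvd_pow_self p (by omega))) _
    · exact Dvd.dvd.mul_right (hX.trans (dvd_pow_self _ (by omega))) _

lemma continuous_eval2 (F : R2) : Continuous (eval2 F) := by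
  unfold eval2
  simp only [eval₂_eq_sum_range, coe_evalRingHom]
  fun_prop

lemma exists_norm_eval2_le (F : R2) (r : ℝ) :
    ∃ B : ℝ, 0 ≤ B ∧ ∀ p ∈ Metric.closedBall (0 : ℂ × ℂ) r, ‖eval2 F p‖ ≤ B := by
  obtain ⟨B, hB⟩ := (isCompact_closedBall (0 : ℂ × ℂ) r).exists_bound_of_continuousOn
    (continuous_eval2 F).continuousOn
  exact ⟨max B 0, le_max_right _ _, fun p hp => (hB p hp).trans (le_max_left _ _)⟩

/-- A bound for `eval2 F` on the closed ball of radius `r`. -/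
def evalBound (F : R2) (r : ℝ) : ℝ := (exists_norm_eval2_le F r).choose

lemma evalBound_nonneg (F : R2) (r : ℝ) : 0 ≤ evalBound F r :=
  (exists_norm_eval2_le F r).choose_spec.1

lemma norm_eval2_le (F : R2) {r : ℝ} {p : ℂ × ℂ} (hp : p ∈ Metric.closedBall 0 r) :
    ‖eval2 F p‖ ≤ evalBound F r :=
  (exists_norm_eval2_le F r).choose_spec.2 p hp

/-- Coefficients growing so fast that each dominates everything built from the previous ones. -/
def fastCoeff : ℕ → ℂ
  | 0 => 0
  | 1 => 1
  | m + 2 => ((m + 2 : ℕ) * evalBound (expFlow (m + 2)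
      (∑ j : Fin (m + 2), C (fastCoeff j) * X ^ (j : ℕ)) (dividedPow (m + 2))) (m + 2 : ℕ) + 1 : ℝ)

lemma fastCoeff_of_two_le {m : ℕ} (hm : 2 ≤ m) :
    fastCoeff m =
      (m * evalBound (expFlow m (truncSeries fastCoeff m) (dividedPow m)) m + 1 : ℝ) := by
  obtain ⟨m, rfl⟩ := Nat.exists_eq_add_of_le' hm
  rw [fastCoeff, truncSeries, Finset.sum_range]

lemma C_X_add_X_mem_solutionSet : (C X + X : R2) ∈ solutionSet fastCoeff := by
  have h := expFlow_mem_solutionSet (a := fastCoeff) (by simp [fastCoeff]) (natDegree_X_le (R := ℂ))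
  have e : expFlow 1 (truncSeries fastCoeff (1 + 1)) X = C X + X := by
    simp [expFlow, truncSeries, Finset.sum_range_succ, fastCoeff, X]
  rwa [e] at h

lemma C_X_notMem_solutionSet : (C X : R2) ∉ solutionSet fastCoeff := by
  rintro ⟨N, h⟩
  have h' := congrArg (fun F : R2 => F.coeff 0) (h (N + 2) (by omega))
  have key : aeval (derivative : Module.End ℂ ℂ[X])
      (truncSeries fastCoeff (N + 2) - truncSeries fastCoeff 2) X = 0 :=
    aeval_derivative_eq_zero (X_pow_dvd_truncSeries_sub fastCoeff (by omega)) natDegree_X_le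
  rw [map_sub, LinearMap.sub_apply, sub_eq_zero] at key
  rw [aeval_derivX_coeff, coeff_C_zero, key] at h'
  simp [truncSeries, Finset.sum_range_succ, fastCoeff] at h'

/-- Elements of `solutionSet fastCoeff` converging to `x`. -/
def approx (m : ℕ) : R2 :=
  C X - (fastCoeff m)⁻¹ • expFlow m (truncSeries fastCoeff m) (dividedPow m)

lemma fastCoeff_ne_zero {m : ℕ} (hm : 2 ≤ m) : fastCoeff m ≠ 0 := by
  rw [fastCoeff_of_two_le hm, Complex.ofReal_ne_zero]
  have := evalBound_nonneg (expFlow m (truncSeries fastCoeff m) (dividedPow m)) m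
  positivity

lemma approx_mem_solutionSet {m : ℕ} (hm : 2 ≤ m) : approx m ∈ solutionSet fastCoeff := by
  have h0 : fastCoeff 0 = 0 := by simp [fastCoeff]
  have h := expFlow_mem_solutionSet h0 (natDegree_dividedPow_le m)
  have e := expFlow_add_C_mul_X_pow hm (X_dvd_truncSeries h0 m) (fastCoeff m)
  rw [truncSeries, Finset.sum_range_succ, ← truncSeries, e] at h
  have hM := isSubmodule_solutionSet fastCoeff
  have := hM.2.1 _ C_X_add_X_mem_solutionSet _ (hM.2.2.1 (-(fastCoeff m)⁻¹) _ h)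
  convert this using 1
  rw [approx, smul_add, smul_smul, neg_mul, inv_mul_cancel₀ (fastCoeff_ne_zero hm), neg_smul,
    neg_smul, one_smul]
  abel

lemma eval2_smul (c : ℂ) (F : R2) (p : ℂ × ℂ) : eval2 (c • F) p = c * eval2 F p := by
  have h : c • F = C (C c) * F := by
    ext1 n
    simp [smul_eq_C_mul]
  rw [h]
  simp [eval2, eval₂_mul]

lemma dist_eval2_approx_le {m : ℕ} (hm : 2 ≤ m) {p : ℂ × ℂ}
    (hp : p ∈ Metric.closedBall 0 (m : ℝ)) : dist p.1 (eval2 (approx m) p) ≤ 1 / m := by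
  have e : eval2 (approx m) p = p.1 - (fastCoeff m)⁻¹ *
      eval2 (expFlow m (truncSeries fastCoeff m) (dividedPow m)) p := by
    rw [← eval2_smul]
    simp [approx, eval2, eval₂_sub]
  have hB := evalBound_nonneg (expFlow m (truncSeries fastCoeff m) (dividedPow m)) m
  have hle := norm_eval2_le (expFlow m (truncSeries fastCoeff m) (dividedPow m)) hp
  have hm0 : (0 : ℝ) < m := by positivity
  rw [e, dist_eq_norm, sub_sub_cancel, norm_mul, norm_inv, fastCoeff_of_two_le hm,
    Complex.norm_real, Real.norm_of_nonneg (by positivity), inv_mul_eq_div,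
    div_le_div_iff₀ (by positivity) hm0]
  nlinarith

/-- Theorem 6 of the paper: there is a submodule `M` of `ℂ[x,y]` with `x ∉ M`, yet a
sequence in `M` converges to the function `(x,y) ↦ x` uniformly on every compact subset
of `ℂ²`.  In particular, `M` is not relatively closed in `ℂ[x,y]`. -/
theorem stmt13 :
    ∃ M : Set R2, IsSubmodule M ∧ (C X : R2) ∉ M ∧
      ∃ G : ℕ → R2, (∀ n, G n ∈ M) ∧
        ∀ K : Set (ℂ × ℂ), IsCompact K →
          TendstoUniformlyOn (fun n p => eval2 (G n) p) (fun p => p.1) Filter.atTop K := by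
  refine ⟨solutionSet fastCoeff, isSubmodule_solutionSet _, C_X_notMem_solutionSet,
    fun n => approx (n + 2), fun n => approx_mem_solutionSet (by omega), fun K hK => ?_⟩
  obtain ⟨r, hr⟩ := hK.isBounded.subset_closedBall 0
  rw [Metric.tendstoUniformlyOn_iff]
  intro ε hε
  obtain ⟨N, hN⟩ := exists_nat_gt (max r (1 / ε))
  filter_upwards [Filter.eventually_ge_atTop N] with n hn p hp
  have hn' : (N : ℝ) ≤ (n + 2 : ℕ) := by exact_mod_cast (by omega : N ≤ n + 2)
  refine (dist_eval2_approx_le (by omega) (Metric.closedBall_subset_closedBall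
    (((le_max_left _ _).trans hN.le).trans hn') (hr hp))).trans_lt ?_
  rw [one_div_lt (by positivity) hε]
  exact ((le_max_right _ _).trans_lt hN).trans_le hn'
end
end

section
/- Let M be an L-module of order s in ℂ[x,y], and let L : ℂ[x]^s → ℂ[x] be a ℂ-linear map such that [F]_n = L([F]_{n−s},…,[F]_{n−1}) for every F ∈ M and every n ≥ s. If (f_0,…,f_{s−1}) ∈ V_{M,s} and the polynomials f_n for n ≥ s are defined recursively by f_n = L(f_{n−s},…,f_{n−1}), then (f_{n−s},…,f_{n−1}) ∈ V_{M,s} for every n ≥ s. -/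
open Polynomial
open scoped Pointwise BigOperators

noncomputable section

theorem mem_of_forall_sum_pow_smul_mem {K W : Type*} [Field K] [Infinite K] [AddCommGroup W]
    [Module K W] (M : Submodule K W) (v : ℕ → W) (N : ℕ)
    (h : ∀ b : K, ∑ k ∈ Finset.range N, b ^ k • v k ∈ M) (k : ℕ) (hk : k < N) : v k ∈ M := by
  rw [← Submodule.Quotient.mk_eq_zero, ← Module.forall_dual_apply_eq_zero_iff K]
  intro φ
  have hp : (∑ j ∈ Finset.range N, C (φ (M.mkQ (v j))) * X ^ j : Polynomial K) = 0 := by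
    refine Polynomial.funext fun b => ?_
    have hb := congrArg φ ((Submodule.Quotient.mk_eq_zero M).2 (h b))
    rw [← Submodule.mkQ_apply] at hb
    simp only [map_sum, map_smul, map_zero, smul_eq_mul] at hb
    simp only [eval_finsetSum, eval_mul, eval_C, eval_pow, eval_X, eval_zero]
    simpa only [mul_comm] using hb
  have hc := congrArg (fun p => p.coeff k) hp
  simpa [finsetSum_coeff, coeff_C_mul, coeff_X_pow, hk] using hc

theorem polyTranslate_zero_eq_sum (b : ℂ) (F : R2) :
    polyTranslate 0 b F =
      ∑ k ∈ Finset.range (F.natDegree + 2), b ^ k • hasseDeriv k F := by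
  have h1 : polyTranslate 0 b F = taylor (C b) F := by
    have : (aeval (X + C 0) : Polynomial ℂ →ₐ[ℂ] Polynomial ℂ).toRingHom = RingHom.id _ := by
      ext <;> simp
    rw [polyTranslate, this, Polynomial.map_id, taylor_apply]
  ext1 n
  rw [h1, taylor_coeff, finsetSum_coeff,
    eval_eq_sum_range' (n := F.natDegree + 2) (by
      have := natDegree_hasseDeriv_le F n
      omega)]
  refine Finset.sum_congr rfl fun k _ => ?_
  rw [coeff_smul, hasseDeriv_coeff, hasseDeriv_coeff, Polynomial.smul_eq_C_mul, C_pow,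
    add_comm n k, Nat.choose_symm_add]
  ring

theorem IsSubmodule.derivative_mem {M : Set R2} (hM : IsSubmodule M) {F : R2} (hF : F ∈ M) :
    derivative F ∈ M := by
  obtain ⟨h0, hadd, hsmul, htr⟩ := hM
  let S : Submodule ℂ R2 :=
    { carrier := M
      zero_mem' := h0
      add_mem' := fun {a b} ha hb => hadd a ha b hb
      smul_mem' := fun c x hx => hsmul c x hx }
  have h := mem_of_forall_sum_pow_smul_mem S (fun k => hasseDeriv k F) (F.natDegree + 2)
    (fun b => by
      rw [← polyTranslate_zero_eq_sum]
      exact htr F hF 0 b) 1 (by omega)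
  rwa [hasseDeriv_one] at h

theorem IsSubmodule.iterate_derivative_mem {M : Set R2} (hM : IsSubmodule M) {F : R2}
    (hF : F ∈ M) (k : ℕ) : derivative^[k] F ∈ M := by
  induction k with
  | zero => exact hF
  | succ k ih =>
    rw [Function.iterate_succ_apply']
    exact hM.derivative_mem ih

theorem coordPoly_derivative (F : R2) (n : ℕ) :
    coordPoly (derivative F) n = coordPoly F (n + 1) := by
  simp only [coordPoly, coeff_derivative, Nat.factorial_succ, Polynomial.smul_eq_C_mul]
  push_cast
  simp only [C_mul, C_add, map_natCast, map_one]
  ring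

theorem coordPoly_iterate_derivative (F : R2) (k n : ℕ) :
    coordPoly (derivative^[k] F) n = coordPoly F (k + n) := by
  induction k generalizing n with
  | zero => simp
  | succ k ih =>
    rw [Function.iterate_succ_apply', coordPoly_derivative, ih]
    congr 1
    omega

/-- The compatibility condition between `V_{M,s}` and `L`: if `(f_0,…,f_{s−1}) ∈ V_{M,s}`
and `f_n = L(f_{n−s},…,f_{n−1})` for all `n ≥ s`, then `(f_{n−s},…,f_{n−1}) ∈ V_{M,s}`
for every `n ≥ s`. -/
theorem stmt15 (s : ℕ) (hs : 0 < s) (M : Set R2) (hM : IsLModule s M)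
    (L : (Fin s → Polynomial ℂ) →ₗ[ℂ] Polynomial ℂ)
    (hL : ∀ F ∈ M, ∀ n : ℕ, s ≤ n →
      coordPoly F n = L (fun i : Fin s => coordPoly F (n - s + i)))
    (f : ℕ → Polynomial ℂ)
    (hf0 : (fun i : Fin s => f i) ∈ Vset M s)
    (hrec : ∀ n : ℕ, s ≤ n → f n = L (fun i : Fin s => f (n - s + i))) :
    ∀ n : ℕ, s ≤ n → (fun i : Fin s => f (n - s + i)) ∈ Vset M s := by
  obtain ⟨F, hF, hfF⟩ := hf0
  have key : ∀ n, f n = coordPoly F n := by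
    intro n
    induction n using Nat.strong_induction_on with
    | _ n ih =>
      rcases lt_or_ge n s with h | h
      · exact hfF ⟨n, h⟩
      · rw [hrec n h, hL F hF n h]
        congr 1
        funext i
        exact ih _ (by have := i.2; omega)
  intro n _
  refine ⟨derivative^[n - s] F, hM.1.iterate_derivative_mem hF _, fun i => ?_⟩
  rw [coordPoly_iterate_derivative]
  exact key _
end
end
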